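/- arXiv:0707.3401 — 2 statements merged into one kernel-verified Lean document; each statement's English description precedes it below -/
import Mathlib

section
/- Let {μ_{nk}} be an infinitesimal array of probability measures on 𝕋, each with nonzero first moment, and let {λ_n}_{n≥1} ⊂ 𝕋. Then lim_{n→∞} λ_n · Π_{k=1}^{k_n} ∫_𝕋 ζ dμ_{nk}(ζ) = 0 if and only if λ_n · Π_{k=1}^{k_n} B_{μ_{nk}}(z) converges to 0 uniformly on compact subsets of 𝔻 as n → ∞ (i.e., the boolean convolutions δ_{λ_n} ⨃ μ_{n1} ⨃ ⋯ ⨃ μ_{nk_n} converge weakly to Haar measure m on 𝕋). -/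
open MeasureTheory Complex Filter Topology Metric

noncomputable section

instance : MeasurableSpace Circle := borel Circle
instance : BorelSpace Circle := ⟨rfl⟩

/-- ψ_μ(z) = ∫ ζz/(1-ζz) dμ(ζ). -/
def psiT (μ : Measure Circle) (z : ℂ) : ℂ :=
  ∫ ζ : Circle, ((ζ : ℂ) * z) / (1 - (ζ : ℂ) * z) ∂μ

/-- The B-transform of a measure on the circle:
B_μ(z) = (1/z)·ψ_μ(z)/(1+ψ_μ(z)) for z ≠ 0 and B_μ(0) = ∫ ζ dμ. -/
def BT (μ : Measure Circle) (z : ℂ) : ℂ :=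
  if z = 0 then ∫ ζ : Circle, (ζ : ℂ) ∂μ
  else z⁻¹ * (psiT μ z / (1 + psiT μ z))

/-- Infinitesimal triangular array: max_{1≤k≤k_n} μ_{nk}{|ζ-1| ≥ ε} → 0 as n → ∞. -/
def IsInfinitesimalArrayT (kn : ℕ → ℕ) (μ : ℕ → ℕ → Measure Circle) : Prop :=
  ∀ ε : ℝ, 0 < ε → ∀ δ : ENNReal, 0 < δ → ∃ N : ℕ, ∀ n ≥ N, ∀ i < kn n,
    μ n i {ζ : Circle | ε ≤ ‖(ζ : ℂ) - 1‖} < δ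

/-- β = ∫_{|arg ζ|<τ} arg ζ dμ. -/
def betaT (τ : ℝ) (μ : Measure Circle) : ℝ :=
  ∫ ζ in {ζ : Circle | |Complex.arg (ζ : ℂ)| < τ}, Complex.arg (ζ : ℂ) ∂μ

/-- b = e^{iβ} as an element of the circle. -/
def bT (τ : ℝ) (μ : Measure Circle) : Circle := Circle.exp (betaT τ μ)

/-- μ° : the centering of μ, i.e. the pushforward of μ under ζ ↦ b⁻¹ ζ. -/
def centerT (τ : ℝ) (μ : Measure Circle) : Measure Circle :=
  Measure.map (fun ζ => (bT τ μ)⁻¹ * ζ) μ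

/-- h(z) = -i ∫ Im ζ dμ° + ∫ (1+ζz)/(1-ζz)·(1-Re ζ) dμ°, for the centered measure μ°. -/
def hT (τ : ℝ) (μ : Measure Circle) (z : ℂ) : ℂ :=
  -Complex.I * ((∫ ζ : Circle, ((ζ : ℂ)).im ∂(centerT τ μ) : ℝ) : ℂ) +
    ∫ ζ : Circle, ((1 + (ζ : ℂ) * z) / (1 - (ζ : ℂ) * z)) * ((1 - ((ζ : ℂ)).re : ℝ) : ℂ)
      ∂(centerT τ μ)

theorem one_sub_norm_le_norm_one_sub_mul (ζ : Circle) (z : ℂ) :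
    1 - ‖z‖ ≤ ‖1 - (ζ : ℂ) * z‖ := by
  simpa [Circle.norm_coe] using norm_sub_norm_le (1 : ℂ) ((ζ : ℂ) * z)

theorem one_sub_circle_mul_ne_zero (ζ : Circle) {z : ℂ} (hz : ‖z‖ < 1) :
    1 - (ζ : ℂ) * z ≠ 0 :=
  norm_pos_iff.1 ((sub_pos.2 hz).trans_le (one_sub_norm_le_norm_one_sub_mul ζ z))

theorem integrable_of_continuous_circle {E : Type*} [NormedAddCommGroup E] (μ : Measure Circle)
    [IsFiniteMeasure μ] {f : Circle → E} (hf : Continuous f) : Integrable f μ :=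
  hf.integrable_of_hasCompactSupport (HasCompactSupport.of_compactSpace f)

theorem continuous_psiT_integrand {z : ℂ} (hz : ‖z‖ < 1) :
    Continuous fun ζ : Circle => ((ζ : ℂ) * z) / (1 - (ζ : ℂ) * z) :=
  Continuous.div (by fun_prop) (by fun_prop) fun ζ => one_sub_circle_mul_ne_zero ζ hz

theorem hasDerivAt_psiT (μ : Measure Circle) [IsFiniteMeasure μ] {z : ℂ} (hz : ‖z‖ < 1) :
    HasDerivAt (psiT μ) (∫ ζ : Circle, (ζ : ℂ) / (1 - (ζ : ℂ) * z) ^ 2 ∂μ) z := by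
  set ε : ℝ := (1 - ‖z‖) / 2 with hε
  have hε0 : 0 < ε := by linarith
  have hball : ∀ w ∈ ball z ε, ‖w‖ < 1 - ε := by
    intro w hw
    have h1 := norm_sub_norm_le w z
    have h2 : ‖w - z‖ < ε := mem_ball_iff_norm.1 hw
    linarith
  refine (hasDerivAt_integral_of_dominated_loc_of_deriv_le (μ := μ)
    (F := fun w (ζ : Circle) => ((ζ : ℂ) * w) / (1 - (ζ : ℂ) * w))
    (F' := fun w (ζ : Circle) => (ζ : ℂ) / (1 - (ζ : ℂ) * w) ^ 2)
    (bound := fun _ => 1 / ε ^ 2) (ball_mem_nhds z hε0) ?_ ?_ ?_ ?_ (integrable_const _) ?_).2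
  · filter_upwards [ball_mem_nhds z hε0] with w hw
    exact (continuous_psiT_integrand (by linarith [hball w hw])).aestronglyMeasurable
  · exact integrable_of_continuous_circle μ (continuous_psiT_integrand hz)
  · refine Continuous.aestronglyMeasurable (Continuous.div (by fun_prop) (by fun_prop) fun ζ => ?_)
    exact pow_ne_zero 2 (one_sub_circle_mul_ne_zero ζ hz)
  · refine ae_of_all _ fun ζ w hw => ?_
    have h1 : ε ≤ ‖1 - (ζ : ℂ) * w‖ := by
      linarith [one_sub_norm_le_norm_one_sub_mul ζ w, hball w hw]
    rw [norm_div, norm_pow, Circle.norm_coe]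
    gcongr
  · refine ae_of_all _ fun ζ w hw => ?_
    have h0 := one_sub_circle_mul_ne_zero ζ (z := w) (by linarith [hball w hw])
    have h1 : HasDerivAt (fun w : ℂ => (ζ : ℂ) * w) (ζ : ℂ) w := by
      simpa using (hasDerivAt_id w).const_mul (ζ : ℂ)
    refine (h1.div (h1.const_sub 1) h0).congr_deriv ?_
    congr 1
    ring

theorem psiT_zero (μ : Measure Circle) : psiT μ 0 = 0 := by
  simp [psiT]

theorem neg_half_le_re_div_one_sub {w : ℂ} (hw : ‖w‖ < 1) : -(1 / 2) ≤ (w / (1 - w)).re := by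
  have hne : 1 - w ≠ 0 := fun h => by
    rw [← sub_eq_zero.1 h, norm_one] at hw
    exact lt_irrefl _ hw
  have hN : 0 < normSq (1 - w) := normSq_pos.2 hne
  have h1 : normSq w < 1 := by
    rw [normSq_eq_norm_sq]
    nlinarith [norm_nonneg w]
  rw [div_re, ← add_div, le_div_iff₀ hN]
  simp only [normSq_apply, sub_re, sub_im, one_re, one_im] at *
  nlinarith

theorem neg_half_le_re_psiT (μ : Measure Circle) [IsProbabilityMeasure μ] {z : ℂ}
    (hz : ‖z‖ < 1) : -(1 / 2) ≤ (psiT μ z).re := by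
  have hi := integrable_of_continuous_circle μ (continuous_psiT_integrand hz)
  have h : ∫ _ : Circle, (-(1 / 2) : ℝ) ∂μ ≤
      ∫ ζ : Circle, (((ζ : ℂ) * z) / (1 - (ζ : ℂ) * z)).re ∂μ :=
    integral_mono (integrable_const _) hi.re fun ζ =>
      neg_half_le_re_div_one_sub (by simpa [Circle.norm_coe] using hz)
  rw [show (psiT μ z).re = ∫ ζ : Circle, (((ζ : ℂ) * z) / (1 - (ζ : ℂ) * z)).re ∂μ from
    (integral_re hi).symm]
  simpa using h

theorem one_add_psiT_ne_zero (μ : Measure Circle) [IsProbabilityMeasure μ] {z : ℂ}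
    (hz : ‖z‖ < 1) : 1 + psiT μ z ≠ 0 := fun h => by
  have h1 := neg_half_le_re_psiT μ hz
  have h2 := congrArg re h
  simp only [add_re, one_re, zero_re] at h2
  linarith

/-- The η-transform `ψ_μ / (1 + ψ_μ)`. -/
def etaT (μ : Measure Circle) (z : ℂ) : ℂ := psiT μ z / (1 + psiT μ z)

theorem etaT_zero (μ : Measure Circle) : etaT μ 0 = 0 := by
  simp [etaT, psiT_zero]

theorem norm_etaT_le_one (μ : Measure Circle) [IsProbabilityMeasure μ] {z : ℂ}
    (hz : ‖z‖ < 1) : ‖etaT μ z‖ ≤ 1 := by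
  have h1 := neg_half_le_re_psiT μ hz
  rw [etaT, norm_div, div_le_one (norm_pos_iff.2 (one_add_psiT_ne_zero μ hz)),
    ← sq_le_sq₀ (norm_nonneg _) (norm_nonneg _), ← normSq_eq_norm_sq, ← normSq_eq_norm_sq,
    normSq_apply, normSq_apply, add_re, add_im, one_re, one_im]
  nlinarith

theorem differentiableOn_etaT (μ : Measure Circle) [IsProbabilityMeasure μ] :
    DifferentiableOn ℂ (etaT μ) (ball 0 1) := by
  have hψ : DifferentiableOn ℂ (psiT μ) (ball 0 1) := fun z hz =>
    (hasDerivAt_psiT μ (mem_ball_zero_iff.1 hz)).differentiableAt.differentiableWithinAt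
  exact hψ.div (hψ.const_add 1) fun z hz => one_add_psiT_ne_zero μ (mem_ball_zero_iff.1 hz)

theorem hasDerivAt_etaT_zero (μ : Measure Circle) [IsProbabilityMeasure μ] :
    HasDerivAt (etaT μ) (∫ ζ : Circle, (ζ : ℂ) ∂μ) 0 := by
  have h := hasDerivAt_psiT μ (z := 0) (by simp)
  refine (h.div (h.const_add 1) (by simp [psiT_zero])).congr_deriv ?_
  simp [psiT_zero]

theorem BT_zero (μ : Measure Circle) : BT μ 0 = ∫ ζ : Circle, (ζ : ℂ) ∂μ := if_pos rfl

theorem BT_eq_dslope (μ : Measure Circle) [IsProbabilityMeasure μ] :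
    BT μ = dslope (etaT μ) 0 := by
  ext z
  rcases eq_or_ne z 0 with rfl | hz
  · rw [BT_zero, dslope_same, (hasDerivAt_etaT_zero μ).deriv]
  · rw [BT, if_neg hz, dslope_of_ne _ hz, slope_def_module, etaT_zero, sub_zero, sub_zero,
      smul_eq_mul, etaT]

theorem norm_BT_le_one (μ : Measure Circle) [IsProbabilityMeasure μ] {z : ℂ} (hz : ‖z‖ < 1) :
    ‖BT μ z‖ ≤ 1 := by
  rw [BT_eq_dslope]
  simpa using norm_dslope_le_div_of_mapsTo_ball (R₂ := 1) (differentiableOn_etaT μ)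
    (fun w hw => by
      simpa [etaT_zero] using norm_etaT_le_one μ (mem_ball_zero_iff.1 hw))
    (mem_ball_zero_iff.2 hz)

theorem differentiableOn_BT (μ : Measure Circle) [IsProbabilityMeasure μ] :
    DifferentiableOn ℂ (BT μ) (ball 0 1) := by
  rw [BT_eq_dslope]
  exact (differentiableOn_dslope (ball_mem_nhds 0 one_pos)).2 (differentiableOn_etaT μ)

theorem normSq_one_sub_conj_mul_sub_normSq_sub (b w : ℂ) :
    ‖1 - (starRingEnd ℂ) b * w‖ ^ 2 - ‖w - b‖ ^ 2 = (1 - ‖b‖ ^ 2) * (1 - ‖w‖ ^ 2) := by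
  simp only [← normSq_eq_norm_sq, normSq_apply, sub_re, sub_im, mul_re, mul_im, one_re, one_im,
    conj_re, conj_im]
  ring

/-- A weak form of the Schwarz–Pick lemma, bounding `1 - ‖f z‖` below by a multiple of
`1 - ‖f 0‖`. -/
theorem norm_le_one_sub_of_norm_le_one {f : ℂ → ℂ} (hf : DifferentiableOn ℂ f (ball 0 1))
    (hb : ∀ z : ℂ, ‖z‖ < 1 → ‖f z‖ ≤ 1) {z : ℂ} (hz : ‖z‖ < 1) :
    ‖f z‖ ≤ 1 - (1 - ‖z‖ ^ 2) / 4 * (1 - ‖f 0‖) := by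
  have hb0 : ‖f 0‖ ≤ 1 := hb 0 (by simp)
  rcases hb0.eq_or_lt with h1 | h1
  · simpa [h1] using hb z hz
  set b := f 0 with hb_def
  have hden : ∀ w : ℂ, ‖w‖ < 1 → 1 - ‖b‖ ≤ ‖1 - (starRingEnd ℂ) b * f w‖ := by
    intro w hw
    have h2 := norm_sub_norm_le (1 : ℂ) ((starRingEnd ℂ) b * f w)
    rw [norm_one, norm_mul, RCLike.norm_conj] at h2
    nlinarith [hb w hw, norm_nonneg b]
  have hpos : ∀ w : ℂ, ‖w‖ < 1 → 0 < ‖1 - (starRingEnd ℂ) b * f w‖ := fun w hw =>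
    (sub_pos.2 h1).trans_le (hden w hw)
  have hb2 : 0 ≤ 1 - ‖b‖ ^ 2 := by nlinarith [norm_nonneg b]
  have hdiff : DifferentiableOn ℂ (fun w => (f w - b) / (1 - (starRingEnd ℂ) b * f w))
      (ball 0 1) :=
    (hf.sub_const b).div ((hf.const_mul _).const_sub 1) fun w hw =>
      norm_pos_iff.1 (hpos w (mem_ball_zero_iff.1 hw))
  have hmaps : Set.MapsTo (fun w => (f w - b) / (1 - (starRingEnd ℂ) b * f w))
      (ball 0 1) (closedBall 0 1) := by
    intro w hw
    have hw' := mem_ball_zero_iff.1 hw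
    rw [mem_closedBall_zero_iff, norm_div, div_le_one (hpos w hw'),
      ← sq_le_sq₀ (norm_nonneg _) (norm_nonneg _), ← sub_nonneg,
      normSq_one_sub_conj_mul_sub_normSq_sub]
    exact mul_nonneg hb2 (by nlinarith [hb w hw', norm_nonneg (f w)])
  have hS := norm_le_norm_of_mapsTo_ball hdiff hmaps (by simp [hb_def]) hz
  rw [norm_div, div_le_iff₀ (hpos z hz)] at hS
  have hS2 := pow_le_pow_left₀ (norm_nonneg _) hS 2
  rw [mul_pow] at hS2
  have hid := normSq_one_sub_conj_mul_sub_normSq_sub b (f z)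
  have hd2 := pow_le_pow_left₀ (sub_nonneg.2 hb0) (hden z hz) 2
  have hz2 : 0 ≤ 1 - ‖z‖ ^ 2 := by nlinarith [norm_nonneg z]
  have h3 : (1 - ‖z‖ ^ 2) * (1 - ‖b‖) ^ 2 ≤ (1 - ‖b‖ ^ 2) * (1 - ‖f z‖ ^ 2) := by
    linarith [mul_le_mul_of_nonneg_left hd2 hz2]
  have h4 : (1 - ‖z‖ ^ 2) * (1 - ‖b‖) ≤ (1 + ‖b‖) * (1 - ‖f z‖ ^ 2) := by
    refine le_of_mul_le_mul_left ?_ (sub_pos.2 h1)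
    linarith
  have h5 := norm_nonneg (f z)
  have h6 := hb z hz
  have h7 : (1 + ‖b‖) * (1 - ‖f z‖ ^ 2) ≤ 2 * (2 * (1 - ‖f z‖)) := by
    gcongr
    · nlinarith
    · linarith
    · nlinarith
  linarith

theorem one_sub_mul_le_rpow {a c : ℝ} (ha : 1 / 2 ≤ a) (ha1 : a ≤ 1) (hc : 0 ≤ c) :
    1 - c * (1 - a) ≤ a ^ (c / 2) := by
  have ha0 : 0 < a := by linarith
  have hlog := Real.one_sub_inv_le_log_of_pos ha0
  have hinv : -2 * (1 - a) ≤ 1 - a⁻¹ := by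
    have hmul : a * a⁻¹ = 1 := mul_inv_cancel₀ ha0.ne'
    have hle : a⁻¹ ≤ 2 := by simpa using inv_anti₀ (by norm_num) ha
    nlinarith [mul_nonneg (sub_nonneg.2 ha1) (sub_nonneg.2 hle)]
  rw [Real.rpow_def_of_pos ha0]
  have h := Real.add_one_le_exp (-(c * (1 - a)))
  have h2 : -(c * (1 - a)) ≤ Real.log a * (c / 2) := by nlinarith
  linarith [Real.exp_le_exp.2 h2]

theorem norm_BT_le_rpow (μ : Measure Circle) [IsProbabilityMeasure μ]
    (hμ : 1 / 2 ≤ ‖∫ ζ : Circle, (ζ : ℂ) ∂μ‖) {r : ℝ} (hr : r < 1) {z : ℂ} (hz : ‖z‖ ≤ r) :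
    ‖BT μ z‖ ≤ ‖∫ ζ : Circle, (ζ : ℂ) ∂μ‖ ^ ((1 - r ^ 2) / 8) := by
  have h1 := norm_le_one_sub_of_norm_le_one (differentiableOn_BT μ)
    (fun w hw => norm_BT_le_one μ hw) (hz.trans_lt hr)
  have h0 := norm_BT_le_one μ (z := 0) (by simp)
  rw [BT_zero] at h0 h1
  have hr0 := (norm_nonneg z).trans hz
  have h2 := one_sub_mul_le_rpow hμ h0 (c := (1 - r ^ 2) / 4) (by nlinarith)
  rw [show (1 - r ^ 2) / 4 / 2 = (1 - r ^ 2) / 8 by ring] at h2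
  refine h1.trans (le_trans ?_ h2)
  gcongr

theorem half_le_norm_integral_circle (μ : Measure Circle) [IsProbabilityMeasure μ]
    (hμ : μ {ζ : Circle | 1 / 8 ≤ ‖(ζ : ℂ) - 1‖} < ENNReal.ofReal (1 / 8)) :
    1 / 2 ≤ ‖∫ ζ : Circle, (ζ : ℂ) ∂μ‖ := by
  set S : Set Circle := {ζ : Circle | 1 / 8 ≤ ‖(ζ : ℂ) - 1‖} with hS_def
  have hS : MeasurableSet S := (isClosed_le (by fun_prop) (by fun_prop)).measurableSet
  have hreal : μ.real S ≤ 1 / 8 := ENNReal.toReal_le_of_le_ofReal (by norm_num) hμ.le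
  have hcont : Continuous fun ζ : Circle => (ζ : ℂ) := by fun_prop
  have hsub : ∫ ζ : Circle, ((ζ : ℂ) - 1) ∂μ = (∫ ζ : Circle, (ζ : ℂ) ∂μ) - 1 := by
    rw [integral_sub (integrable_of_continuous_circle μ hcont) (integrable_const _)]
    simp
  have hle : ‖∫ ζ : Circle, ((ζ : ℂ) - 1) ∂μ‖ ≤
      ∫ ζ : Circle, (1 / 8 + S.indicator (fun _ => (2 : ℝ)) ζ) ∂μ := by
    refine norm_integral_le_of_norm_le
      ((integrable_const _).add ((integrable_const _).indicator hS)) (ae_of_all _ fun ζ => ?_)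
    by_cases hζ : ζ ∈ S
    · have h2 := norm_sub_le (ζ : ℂ) 1
      rw [Circle.norm_coe, norm_one] at h2
      rw [Set.indicator_of_mem hζ]
      linarith
    · rw [Set.indicator_of_notMem hζ, add_zero]
      exact (not_le.1 hζ).le
  rw [integral_add (integrable_const _) ((integrable_const _).indicator hS),
    integral_indicator_const _ hS, integral_const, hsub] at hle
  simp only [probReal_univ, smul_eq_mul] at hle
  have h3 := norm_sub_norm_le (1 : ℂ) (∫ ζ : Circle, (ζ : ℂ) ∂μ)
  rw [norm_one, norm_sub_rev] at h3
  linarith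

/-- Theorem 4.3: λ_n·Π_k ∫ζ dμ_{nk} → 0 iff the boolean convolutions
δ_{λ_n} ⨃ μ_{n1} ⨃ ⋯ ⨃ μ_{nk_n} converge weakly to Haar measure
(B-transforms → 0 uniformly on compacts of 𝔻). -/
theorem stmt13
    (kn : ℕ → ℕ) (μ : ℕ → ℕ → Measure Circle)
    (hprob : ∀ n i, IsProbabilityMeasure (μ n i))
    (hinf : IsInfinitesimalArrayT kn μ)
    (hmom : ∀ n : ℕ, ∀ i < kn n, (∫ ζ : Circle, (ζ : ℂ) ∂(μ n i)) ≠ 0)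
    (lam : ℕ → Circle) :
    Tendsto (fun n => ((lam n : ℂ)) *
        ∏ i ∈ Finset.range (kn n), ∫ ζ : Circle, (ζ : ℂ) ∂(μ n i))
      atTop (𝓝 (0 : ℂ)) ↔
    (∀ K : Set ℂ, K ⊆ ball (0:ℂ) 1 → IsCompact K →
      TendstoUniformlyOn
        (fun n z => ((lam n : ℂ)) * ∏ i ∈ Finset.range (kn n), BT (μ n i) z)
        (fun _ => (0 : ℂ)) atTop K) := by
  constructor
  · intro h K hK hKc
    obtain ⟨r, hr, hKr⟩ := exists_lt_subset_ball hKc.isClosed hK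
    rcases K.eq_empty_or_nonempty with rfl | ⟨z₀, hz₀⟩
    · exact tendstoUniformlyOn_empty
    have hr0 : 0 ≤ r := (norm_nonneg z₀).trans (mem_ball_zero_iff.1 (hKr hz₀)).le
    have hc : 0 < (1 - r ^ 2) / 8 := by nlinarith
    have hlim := h.norm.rpow_const (p := (1 - r ^ 2) / 8) (Or.inr hc.le)
    rw [norm_zero, Real.zero_rpow hc.ne'] at hlim
    obtain ⟨N, hN⟩ := hinf (1 / 8) (by norm_num) (ENNReal.ofReal (1 / 8)) (by norm_num)
    rw [Metric.tendstoUniformlyOn_iff]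
    intro ε hε
    filter_upwards [hlim.eventually (gt_mem_nhds hε), eventually_ge_atTop N] with n hn hnN z hz
    rw [dist_zero_left]
    refine lt_of_le_of_lt ?_ hn
    rw [norm_mul, norm_mul, Circle.norm_coe, one_mul, one_mul, norm_prod, norm_prod,
      ← Real.finsetProd_rpow _ _ fun i _ => norm_nonneg _]
    refine Finset.prod_le_prod (fun i _ => norm_nonneg _) fun i hi => ?_
    exact norm_BT_le_rpow (μ n i)
      (half_le_norm_integral_circle (μ n i) (hN n hnN i (Finset.mem_range.1 hi))) hr
      (mem_ball_zero_iff.1 (hKr hz)).le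
  · intro h
    have h0 := (h {0} (by simp) isCompact_singleton).tendsto_at (Set.mem_singleton (0 : ℂ))
    simpa only [BT_zero] using h0

end
end

section
/- Let {ν_{nk}} be an infinitesimal array of probability measures on ℝ and fix α, β > 0. Then there exist N ∈ ℕ and functions v_{nk} : Γ_{α,β} → ℂ such that for all n ≥ N, 1 ≤ k ≤ k_n and z ∈ Γ_{α,β} one has E_{ν_{nk}°}(z) = f_{nk}(z + a_{nk})·(1 + v_{nk}(z)), and the quantities v_n(z) := max_{1≤k≤k_n} |v_{nk}(z)| satisfy: (i) lim_{n→∞} v_n(z) = 0 for every z ∈ Γ_{α,β}; (ii) for every ε > 0 there is R > 0 such that v_n(z) < ε for all n ≥ N and all z ∈ Γ_{α,β} with |z| ≥ R. -/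
open MeasureTheory Complex Filter Topology

noncomputable section

/-- Cauchy transform G_μ(z) = ∫ (z−t)⁻¹ dμ(t), z ∈ ℂ⁺. -/
def cauchyT (μ : Measure ℝ) (z : ℂ) : ℂ := ∫ t : ℝ, (z - (t : ℂ))⁻¹ ∂μ

/-- E_μ(z) = z − F_μ(z), where F_μ = 1/G_μ. -/
def ET (μ : Measure ℝ) (z : ℂ) : ℂ := z - (cauchyT μ z)⁻¹

/-- Infinitesimal triangular array on ℝ: max_{1≤k≤k_n} ν_{nk}{|t| ≥ ε} → 0 as n → ∞. -/
def IsInfinitesimalArrayR (kn : ℕ → ℕ) (ν : ℕ → ℕ → Measure ℝ) : Prop :=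
  ∀ ε : ℝ, 0 < ε → ∀ δ : ENNReal, 0 < δ → ∃ N : ℕ, ∀ n ≥ N, ∀ i < kn n,
    ν n i {t : ℝ | ε ≤ |t|} < δ

/-- a = ∫_{|t|<1} t dν(t). -/
def aR (ν : Measure ℝ) : ℝ := ∫ t in {t : ℝ | |t| < 1}, t ∂ν

/-- ν° : the centering of ν, pushforward under t ↦ t − a. -/
def centerR (ν : Measure ℝ) : Measure ℝ := Measure.map (fun t => t - aR ν) ν

/-- f(z) = ∫ tz/(z−t) dν°(t). -/
def fR (ν : Measure ℝ) (z : ℂ) : ℂ :=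
  ∫ t : ℝ, ((t : ℂ) * z) / (z - (t : ℂ)) ∂(centerR ν)

/-- The truncated cone Γ_{α,β} = {x+iy : |x| < αy, y > β}. -/
def cone (α β : ℝ) : Set ℂ := {z : ℂ | |z.re| < α * z.im ∧ β < z.im}

/-- The integral `∫ tz/(z−t) dμ(t)`. -/
def energyT (μ : Measure ℝ) (z : ℂ) : ℂ :=
  ∫ t : ℝ, ((t : ℂ) * z) / (z - (t : ℂ)) ∂μ

lemma im_le_norm_sub_ofReal (z : ℂ) (t : ℝ) : z.im ≤ ‖z - (t : ℂ)‖ := by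
  have h := Complex.abs_im_le_norm (z - (t : ℂ))
  simp only [sub_im, ofReal_im, sub_zero] at h
  exact (le_abs_self _).trans h

lemma sub_ofReal_ne_zero {z : ℂ} (hz : 0 < z.im) (t : ℝ) : z - (t : ℂ) ≠ 0 :=
  norm_pos_iff.mp (hz.trans_le (im_le_norm_sub_ofReal z t))

lemma norm_ofReal_div_sub_le {z : ℂ} (hz : 0 < z.im) (t : ℝ) :
    ‖(t : ℂ) / (z - t)‖ ≤ 1 + ‖z‖ / z.im := by
  have h0 := sub_ofReal_ne_zero hz t
  have e : (t : ℂ) / (z - t) = z / (z - t) - 1 := by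
    field_simp; ring
  rw [e]
  have h1 : ‖z / (z - t)‖ ≤ ‖z‖ / z.im := by
    rw [norm_div]
    gcongr
    exact im_le_norm_sub_ofReal z t
  have h2 := norm_sub_le (z / (z - t)) 1
  rw [norm_one] at h2
  linarith

lemma integrable_ofReal_div_sub (μ : Measure ℝ) [IsFiniteMeasure μ] {z : ℂ} (hz : 0 < z.im) :
    Integrable (fun t : ℝ => (t : ℂ) / (z - t)) μ := by
  have h : Measurable fun t : ℝ => (t : ℂ) / (z - t) := by fun_prop
  exact Integrable.of_bound h.aestronglyMeasurable _ (ae_of_all _ (norm_ofReal_div_sub_le hz))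

lemma integrable_ofReal_mul_div_sub (μ : Measure ℝ) [IsFiniteMeasure μ] {z : ℂ}
    (hz : 0 < z.im) : Integrable (fun t : ℝ => ((t : ℂ) * z) / (z - t)) μ := by
  refine ((integrable_ofReal_div_sub μ hz).mul_const z).congr (ae_of_all _ fun t => ?_)
  simp only
  ring

lemma energyT_div (μ : Measure ℝ) {z : ℂ} (hz : z ≠ 0) :
    energyT μ z / z = ∫ t : ℝ, (t : ℂ) / (z - t) ∂μ := by
  rw [energyT, ← integral_div]
  congr 1 with t
  field_simp

lemma mul_cauchyT (μ : Measure ℝ) [IsProbabilityMeasure μ] {z : ℂ} (hz : 0 < z.im) :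
    z * cauchyT μ z = 1 + energyT μ z / z := by
  have hz0 : z ≠ 0 := by rintro rfl; simp at hz
  rw [energyT_div μ hz0, cauchyT, ← integral_const_mul]
  have h1 : (1 : ℂ) = ∫ _ : ℝ, (1 : ℂ) ∂μ := by simp
  rw [h1, ← integral_add (integrable_const _) (integrable_ofReal_div_sub μ hz)]
  congr 1 with t
  have h0 := sub_ofReal_ne_zero hz t
  field_simp
  ring

lemma im_ofReal_mul_div_sub (z : ℂ) (t : ℝ) :
    (((t : ℂ) * z) / (z - t)).im = -(z.im * (t ^ 2 / ‖z - t‖ ^ 2)) := by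
  rw [Complex.div_im, ← Complex.normSq_eq_norm_sq]
  simp
  ring

lemma im_mul_integral_sq_le (μ : Measure ℝ) [IsFiniteMeasure μ] {z : ℂ} (hz : 0 < z.im) :
    z.im * ∫ t : ℝ, t ^ 2 / ‖z - t‖ ^ 2 ∂μ ≤ ‖energyT μ z‖ := by
  have h : (energyT μ z).im = -(z.im * ∫ t : ℝ, t ^ 2 / ‖z - t‖ ^ 2 ∂μ) := by
    have h1 := integral_im (𝕜 := ℂ) (integrable_ofReal_mul_div_sub μ hz)
    simp only [RCLike.im_to_complex, im_ofReal_mul_div_sub] at h1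
    rw [energyT, ← h1, integral_neg, integral_const_mul]
  have h2 := Complex.abs_im_le_norm (energyT μ z)
  rw [h, abs_neg] at h2
  exact (le_abs_self _).trans h2

/-- A real translation changes `energyT` by a small relative amount. -/
lemma norm_energyT_add_sub_le (μ : Measure ℝ) [IsFiniteMeasure μ] {z : ℂ} (hz : 0 < z.im)
    {a : ℝ} (ha : |a| ≤ z.im / 2) :
    ‖energyT μ (z + a) - energyT μ z‖ ≤ 2 * |a| / z.im * ‖energyT μ z‖ := by
  have hw : 0 < (z + (a : ℂ)).im := by simpa using hz
  have hsq : Integrable (fun t : ℝ => t ^ 2 / ‖z - t‖ ^ 2) μ := by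
    refine (integrable_ofReal_div_sub μ hz).norm.bdd_mul
      (c := 1 + ‖z‖ / z.im) (f := fun t : ℝ => ‖(t : ℂ) / (z - t)‖) ?_ ?_ |>.congr ?_
    · exact (integrable_ofReal_div_sub μ hz).norm.aestronglyMeasurable
    · exact ae_of_all _ fun t => by simpa using norm_ofReal_div_sub_le hz t
    · refine ae_of_all _ fun t => ?_
      simp only [norm_div, norm_real, Real.norm_eq_abs]
      rw [← sq_abs t]
      ring
  have key : ‖energyT μ (z + a) - energyT μ z‖
      ≤ ∫ t : ℝ, 2 * |a| * (t ^ 2 / ‖z - t‖ ^ 2) ∂μ := by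
    rw [energyT, energyT, ← integral_sub (integrable_ofReal_mul_div_sub μ hw)
      (integrable_ofReal_mul_div_sub μ hz)]
    refine norm_integral_le_of_norm_le (hsq.const_mul _) (ae_of_all _ fun t => ?_)
    have h1 := sub_ofReal_ne_zero hz t
    have h2 := sub_ofReal_ne_zero hw t
    have e : (t : ℂ) * (z + a) / (z + a - t) - t * z / (z - t)
        = -(a * (t ^ 2 / ((z + a - t) * (z - t)))) := by
      field_simp
      ring
    have h3 : ‖z - t‖ / 2 ≤ ‖z + a - t‖ := by
      have h4 := norm_sub_le (z + a - t) (a : ℂ)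
      rw [show z + (a : ℂ) - t - a = z - t by ring, norm_real, Real.norm_eq_abs] at h4
      have := im_le_norm_sub_ofReal z t
      linarith
    have h5 : 0 < ‖z - t‖ := norm_pos_iff.mpr h1
    rw [e, norm_neg, norm_mul, norm_div, norm_mul, norm_pow, norm_real, norm_real,
      Real.norm_eq_abs, Real.norm_eq_abs, sq_abs]
    calc |a| * (t ^ 2 / (‖z + a - t‖ * ‖z - t‖))
        ≤ |a| * (t ^ 2 / (‖z - t‖ / 2 * ‖z - t‖)) := by gcongr
      _ = 2 * |a| * (t ^ 2 / ‖z - t‖ ^ 2) := by field_simp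
  rw [integral_const_mul] at key
  refine key.trans ?_
  have h := im_mul_integral_sq_le μ hz
  calc 2 * |a| * ∫ t : ℝ, t ^ 2 / ‖z - t‖ ^ 2 ∂μ
      = 2 * |a| / z.im * (z.im * ∫ t : ℝ, t ^ 2 / ‖z - t‖ ^ 2 ∂μ) := by field_simp
    _ ≤ _ := by gcongr

lemma norm_le_of_mem_cone {α β : ℝ} {z : ℂ} (hz : z ∈ cone α β) (hy : 0 < z.im) :
    ‖z‖ ≤ (1 + α) * z.im := by
  have h := Complex.norm_le_abs_re_add_abs_im z
  rw [abs_of_pos hy] at h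
  linarith [hz.1]

lemma norm_energyT_div_le (μ : Measure ℝ) [IsProbabilityMeasure μ] {α β : ℝ}
    {z : ℂ} (hz : z ∈ cone α β) (hy : 0 < z.im) {ε : ℝ} (hε : 0 < ε) :
    ‖energyT μ z / z‖ ≤ ε / z.im + (α + 2) * μ.real {t : ℝ | ε ≤ |t|} := by
  have hz0 : z ≠ 0 := by rintro rfl; simp at hy
  have hS : MeasurableSet {t : ℝ | ε ≤ |t|} := measurableSet_le (by fun_prop) (by fun_prop)
  have hi : Integrable ({t : ℝ | ε ≤ |t|}.indicator fun _ => α + 2) μ :=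
    (integrable_const _).indicator hS
  rw [energyT_div μ hz0]
  have : ‖∫ t : ℝ, (t : ℂ) / (z - t) ∂μ‖
      ≤ ∫ t : ℝ, (ε / z.im + {t : ℝ | ε ≤ |t|}.indicator (fun _ => α + 2) t) ∂μ := by
    refine norm_integral_le_of_norm_le ((integrable_const _).add hi) (ae_of_all _ fun t => ?_)
    by_cases ht : ε ≤ |t|
    · rw [Set.indicator_of_mem (by exact ht)]
      have h1 := norm_ofReal_div_sub_le hy t
      have h2 : ‖z‖ / z.im ≤ 1 + α := (div_le_iff₀ hy).mpr (norm_le_of_mem_cone hz hy)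
      have h3 : 0 ≤ ε / z.im := by positivity
      linarith
    · rw [Set.indicator_of_notMem (by exact ht), add_zero, norm_div, norm_real,
        Real.norm_eq_abs]
      have := im_le_norm_sub_ofReal z t
      gcongr
      exact (not_le.mp ht).le
  rw [integral_add (integrable_const _) hi, integral_indicator hS] at this
  simpa [mul_comm] using this

lemma abs_aR_le (ν : Measure ℝ) [IsProbabilityMeasure ν] {ε : ℝ} (hε : 0 < ε) :
    |aR ν| ≤ ε + ν.real {t : ℝ | ε ≤ |t|} := by
  have hS : MeasurableSet {t : ℝ | ε ≤ |t|} := measurableSet_le (by fun_prop) (by fun_prop)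
  have hT : MeasurableSet {t : ℝ | |t| < 1} := measurableSet_lt (by fun_prop) (by fun_prop)
  have hi : Integrable ({t : ℝ | ε ≤ |t|}.indicator fun _ => (1 : ℝ)) ν :=
    (integrable_const _).indicator hS
  rw [aR, ← integral_indicator hT, ← Real.norm_eq_abs]
  have : ‖∫ t : ℝ, {t : ℝ | |t| < 1}.indicator (fun t => t) t ∂ν‖
      ≤ ∫ t : ℝ, (ε + {t : ℝ | ε ≤ |t|}.indicator (fun _ => (1 : ℝ)) t) ∂ν := by
    refine norm_integral_le_of_norm_le ((integrable_const _).add hi) (ae_of_all _ fun t => ?_)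
    simp only [Set.indicator_apply, Set.mem_ofPred_eq, Real.norm_eq_abs]
    split_ifs <;> (try rw [abs_zero]) <;> linarith
  rw [integral_add (integrable_const _) hi, integral_indicator hS] at this
  simpa using this

instance (ν : Measure ℝ) [IsProbabilityMeasure ν] : IsProbabilityMeasure (centerR ν) :=
  Measure.isProbabilityMeasure_map (by fun_prop)

lemma centerR_real_tail_le (ν : Measure ℝ) [IsProbabilityMeasure ν] {b : ℝ}
    (hb : |aR ν| ≤ b) (T : ℝ) :
    (centerR ν).real {t : ℝ | T + b ≤ |t|} ≤ ν.real {t : ℝ | T ≤ |t|} := by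
  have hS : MeasurableSet {t : ℝ | T + b ≤ |t|} := measurableSet_le (by fun_prop) (by fun_prop)
  rw [centerR, map_measureReal_apply (by fun_prop) hS]
  refine measureReal_mono fun t ht => ?_
  simp only [Set.mem_preimage, Set.mem_ofPred_eq] at ht ⊢
  have := abs_sub t (aR ν)
  linarith

/-- The relative error of the approximation of `ET` by the translated `fR`. -/
def relErr (ν : Measure ℝ) (z : ℂ) : ℂ :=
  if fR ν (z + (aR ν : ℂ)) = 0 then 0
  else ET (centerR ν) z / fR ν (z + (aR ν : ℂ)) - 1

lemma norm_energyT_sub_fR_le (ν : Measure ℝ) [IsProbabilityMeasure ν] {z : ℂ} (hy : 0 < z.im)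
    (ha : |aR ν| ≤ z.im / 2) :
    ‖energyT (centerR ν) z - fR ν (z + (aR ν : ℂ))‖
      ≤ 2 * |aR ν| / z.im * ‖fR ν (z + (aR ν : ℂ))‖ := by
  have h := norm_energyT_add_sub_le (centerR ν) (z := z + (aR ν : ℂ)) (a := -aR ν)
    (by simpa using hy) (by simpa using ha)
  simpa [energyT, fR] using h

lemma ET_eq_fR_mul (ν : Measure ℝ) [IsProbabilityMeasure ν] {z : ℂ} (hy : 0 < z.im)
    (ha : |aR ν| ≤ z.im / 2) :
    ET (centerR ν) z = fR ν (z + (aR ν : ℂ)) * (1 + relErr ν z) := by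
  have hz0 : z ≠ 0 := by rintro rfl; simp at hy
  rw [relErr]
  split_ifs with h
  · have h1 := norm_energyT_sub_fR_le ν hy ha
    rw [h, norm_zero, mul_zero, sub_zero, norm_le_zero_iff] at h1
    have h2 := mul_cauchyT (centerR ν) hy
    rw [h1, zero_div, add_zero] at h2
    rw [h, zero_mul, ET, eq_inv_of_mul_eq_one_right h2, inv_inv, sub_self]
  · field_simp
    ring

lemma norm_relErr_le (ν : Measure ℝ) [IsProbabilityMeasure ν] {z : ℂ} (hy : 0 < z.im)
    (ha : |aR ν| ≤ z.im / 2) {η : ℝ} (hη : η ≤ 1 / 2) (h1 : 2 * |aR ν| / z.im ≤ η)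
    (h2 : ‖energyT (centerR ν) z / z‖ ≤ η) : ‖relErr ν z‖ ≤ 4 * η := by
  have hz0 : z ≠ 0 := by rintro rfl; simp at hy
  have hη0 : 0 ≤ η := (norm_nonneg _).trans h2
  rw [relErr]
  split_ifs with h
  · simpa using hη0
  have hd := norm_energyT_sub_fR_le ν hy ha
  have hm := mul_cauchyT (centerR ν) hy
  set w := fR ν (z + (aR ν : ℂ))
  set f := energyT (centerR ν) z
  set G := cauchyT (centerR ν) z
  have hg : 1 / 2 ≤ ‖1 + f / z‖ := by
    have := norm_sub_le (1 + f / z) (f / z)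
    rw [add_sub_cancel_right, norm_one] at this
    linarith
  have hg0 : 1 + f / z ≠ 0 := norm_pos_iff.mp (by linarith)
  have hG : G ≠ 0 := fun h => hg0 (by rw [← hm, h, mul_zero])
  have he : ‖(f - w) / w‖ ≤ η := by
    rw [norm_div, div_le_iff₀ (norm_pos_iff.mpr h)]
    exact hd.trans (by gcongr)
  have e : ET (centerR ν) z / w - 1 = ((f - w) / w - f / z) / (1 + f / z) := by
    have hE : ET (centerR ν) z = f / (1 + f / z) := by
      rw [← hm, ET]
      have hf : f = z * (z * G - 1) := by rw [hm]; field_simp; ring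
      rw [hf]
      change z - G⁻¹ = _
      field_simp
    rw [hE, div_div, mul_comm, ← div_div, eq_div_iff hg0, sub_mul, div_mul_cancel₀ _ hg0,
      sub_div, div_self h]
    ring
  rw [e, norm_div, div_le_iff₀ (by linarith)]
  have := norm_sub_le ((f - w) / w) (f / z)
  nlinarith

lemma IsInfinitesimalArrayR.exists_real_tail_le {kn : ℕ → ℕ} {ν : ℕ → ℕ → Measure ℝ}
    (hinf : IsInfinitesimalArrayR kn ν) {ε δ : ℝ} (hε : 0 < ε) (hδ : 0 < δ) :
    ∃ N, ∀ n ≥ N, ∀ i < kn n, (ν n i).real {t : ℝ | ε ≤ |t|} ≤ δ := by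
  obtain ⟨N, hN⟩ := hinf ε hε (ENNReal.ofReal δ) (by simpa using hδ)
  exact ⟨N, fun n hn i hi => ENNReal.toReal_le_of_le_ofReal hδ.le (hN n hn i hi).le⟩

lemma IsInfinitesimalArrayR.exists_abs_aR_le {kn : ℕ → ℕ} {ν : ℕ → ℕ → Measure ℝ}
    (hprob : ∀ n i, IsProbabilityMeasure (ν n i))
    (hinf : IsInfinitesimalArrayR kn ν) {ε : ℝ} (hε : 0 < ε) :
    ∃ N, ∀ n ≥ N, ∀ i < kn n, |aR (ν n i)| ≤ ε := by
  obtain ⟨N, hN⟩ := hinf.exists_real_tail_le (half_pos hε) (half_pos hε)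
  refine ⟨N, fun n hn i hi => ?_⟩
  linarith [abs_aR_le (ν n i) (half_pos hε), hN n hn i hi]

lemma tendsto_real_tail (ν : Measure ℝ) [IsFiniteMeasure ν] :
    Tendsto (fun T : ℝ => ν.real {t : ℝ | T ≤ |t|}) atTop (𝓝 0) := by
  have h : Tendsto (fun T : ℝ => ν {t : ℝ | T ≤ |t|}) atTop
      (𝓝 (ν (⋂ T : ℝ, {t : ℝ | T ≤ |t|}))) := by
    refine tendsto_measure_iInter_atTop (fun T => ?_) ?_ ⟨0, measure_ne_top _ _⟩
    · exact (measurableSet_le (by fun_prop) (by fun_prop)).nullMeasurableSet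
    · exact fun S T hST t ht => hST.trans ht
  have h0 : (⋂ T : ℝ, {t : ℝ | T ≤ |t|}) = ∅ := by
    refine Set.eq_empty_iff_forall_notMem.mpr fun t ht => ?_
    have : |t| + 1 ≤ |t| := Set.mem_iInter.mp ht (|t| + 1)
    linarith
  rw [h0, measure_empty] at h
  exact (ENNReal.tendsto_toReal ENNReal.zero_ne_top).comp h

/-- An infinitesimal array is uniformly tight. -/
lemma IsInfinitesimalArrayR.exists_forall_real_tail_le {kn : ℕ → ℕ} {ν : ℕ → ℕ → Measure ℝ}
    (hprob : ∀ n i, IsProbabilityMeasure (ν n i))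
    (hinf : IsInfinitesimalArrayR kn ν) {δ : ℝ} (hδ : 0 < δ) :
    ∃ T : ℝ, 0 < T ∧ ∀ n, ∀ i < kn n, (ν n i).real {t : ℝ | T ≤ |t|} ≤ δ := by
  obtain ⟨N, hN⟩ := hinf.exists_real_tail_le one_pos hδ
  have h : ∀ᶠ T : ℝ in atTop, ∀ n ∈ Finset.range N, ∀ i ∈ Finset.range (kn n),
      (ν n i).real {t : ℝ | T ≤ |t|} ≤ δ := by
    simp only [Filter.eventually_all_finset]
    exact fun n _ i _ => (tendsto_real_tail (ν n i)).eventually_le_const hδ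
  obtain ⟨T, hT, hT1⟩ := (h.and (eventually_ge_atTop 1)).exists
  refine ⟨T, by linarith, fun n i hi => ?_⟩
  rcases lt_or_ge n N with hn | hn
  · exact hT n (Finset.mem_range.mpr hn) i (Finset.mem_range.mpr hi)
  · exact (measureReal_mono fun t ht => hT1.trans ht).trans (hN n hn i hi)

/-- Lemma 5.1: for an infinitesimal array on ℝ and a truncated cone Γ_{α,β},
E_{ν_{nk}°}(z) = f_{nk}(z + a_{nk})(1 + v_{nk}(z)) on Γ_{α,β} for large n, where
v_n(z) = max_k |v_{nk}(z)| → 0 pointwise on Γ_{α,β} and uniformly in n as |z| → ∞. -/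
theorem stmt15
    (α β : ℝ) (hα : 0 < α) (hβ : 0 < β)
    (kn : ℕ → ℕ) (ν : ℕ → ℕ → Measure ℝ)
    (hprob : ∀ n i, IsProbabilityMeasure (ν n i))
    (hinf : IsInfinitesimalArrayR kn ν) :
    ∃ N : ℕ, ∃ v : ℕ → ℕ → ℂ → ℂ,
      (∀ n ≥ N, ∀ i < kn n, ∀ z ∈ cone α β,
        ET (centerR (ν n i)) z
          = fR (ν n i) (z + ((aR (ν n i) : ℝ) : ℂ)) * (1 + v n i z)) ∧
      (∀ z ∈ cone α β, ∀ δ : ℝ, 0 < δ →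
        ∃ N' : ℕ, ∀ n ≥ N', ∀ i < kn n, ‖v n i z‖ < δ) ∧
      (∀ δ : ℝ, 0 < δ → ∃ R : ℝ, 0 < R ∧
        ∀ n ≥ N, ∀ i < kn n, ∀ z ∈ cone α β, R ≤ ‖z‖ → ‖v n i z‖ < δ) := by
  obtain ⟨N, hN⟩ := hinf.exists_abs_aR_le hprob (half_pos hβ)
  refine ⟨N, fun n i => relErr (ν n i), ?_, ?_, ?_⟩
  · intro n hn i hi z hz
    have hy : 0 < z.im := hβ.trans hz.2
    exact ET_eq_fR_mul (ν n i) hy (by linarith [hN n hn i hi, hz.2])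
  · intro z hz δ hδ
    have hy : 0 < z.im := hβ.trans hz.2
    obtain ⟨η, hη0, hη, hηδ⟩ : ∃ η : ℝ, 0 < η ∧ η ≤ 1 / 2 ∧ 4 * η < δ :=
      ⟨min (1 / 2) (δ / 5), by positivity, min_le_left _ _,
        by linarith [min_le_right (1 / 2) (δ / 5)]⟩
    obtain ⟨ε, hε, hεη⟩ : ∃ ε : ℝ, 0 < ε ∧ 2 * ε / z.im + (α + 2) * ε ≤ η := by
      refine ⟨η / (2 / z.im + (α + 2)), by positivity, le_of_eq ?_⟩
      field_simp
    obtain ⟨N₁, hN₁⟩ := hinf.exists_abs_aR_le hprob hε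
    obtain ⟨N₂, hN₂⟩ := hinf.exists_real_tail_le hε hε
    refine ⟨max N (max N₁ N₂), fun n hn i hi => ?_⟩
    simp only [ge_iff_le, max_le_iff] at hn
    have ha := hN₁ n hn.2.1 i hi
    refine (norm_relErr_le (ν n i) hy (by linarith [hN n hn.1 i hi, hz.2]) hη ?_ ?_).trans_lt hηδ
    · have : 2 * |aR (ν n i)| / z.im ≤ 2 * ε / z.im := by gcongr
      have : 0 < (α + 2) * ε := by positivity
      linarith
    · refine (norm_energyT_div_le (centerR (ν n i)) hz hy (add_pos hε hε)).trans ?_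
      refine le_trans ?_ hεη
      rw [← two_mul]
      gcongr
      rw [two_mul]
      exact (centerR_real_tail_le (ν n i) ha ε).trans (hN₂ n hn.2.2 i hi)
  · intro δ hδ
    obtain ⟨η, hη0, hη, hηδ⟩ : ∃ η : ℝ, 0 < η ∧ η ≤ 1 / 2 ∧ 4 * η < δ :=
      ⟨min (1 / 2) (δ / 5), by positivity, min_le_left _ _,
        by linarith [min_le_right (1 / 2) (δ / 5)]⟩
    obtain ⟨T, hT, htail⟩ := hinf.exists_forall_real_tail_le hprob
      (δ := η / 2 / (α + 2)) (by positivity)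
    refine ⟨(1 + α) * (2 * (T + β / 2) / η), by positivity, fun n hn i hi z hz hR => ?_⟩
    have hy : 0 < z.im := hβ.trans hz.2
    have ha := hN n hn i hi
    have hK : 2 * (T + β / 2) / η ≤ z.im :=
      le_of_mul_le_mul_left (hR.trans (norm_le_of_mem_cone hz hy)) (by positivity)
    rw [div_le_iff₀ hη0] at hK
    refine (norm_relErr_le (ν n i) hy (by linarith [hz.2]) hη ?_ ?_).trans_lt hηδ
    · rw [div_le_iff₀ hy]
      linarith
    · refine (norm_energyT_div_le (centerR (ν n i)) hz hy
        (add_pos hT (half_pos hβ))).trans ?_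
      have h1 : (T + β / 2) / z.im ≤ η / 2 := by
        rw [div_le_iff₀ hy]
        linarith
      have h2 : (α + 2) * (centerR (ν n i)).real {t : ℝ | T + β / 2 ≤ |t|} ≤ η / 2 := by
        rw [mul_comm, ← le_div_iff₀ (by positivity)]
        exact (centerR_real_tail_le (ν n i) ha T).trans (htail n i hi)
      linarith

end
end
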